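/- The pushforward of the probability measure m̂ under the homeomorphism Θ' : Ω → (A∖k)^ℤ equals the Bernoulli product measure ν^⊗ℤ, where ν is the probability measure on the countable discrete set A∖k with ν(a) = |a|_∞^{−2} = q^{−2 deg a}. -/

import Mathlib

open MeasureTheory
open scoped ENNReal Classical

noncomputable section

namespace ArtinCoding

variable (k : Type*) [Field k] [Fintype k]

/-- The field `K̂ = k((X⁻¹))` of formal Laurent series in `X⁻¹` over `k`, realized as the
field of formal Laurent series `k((t))` in the variable `t = X⁻¹`. -/
abbrev Khat := LaurentSeries k

variable {k}

/-- The absolute value `|f|_∞ = q^{-v_∞(f)}`, where `v_∞` is the order of vanishing in the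
variable `t = X⁻¹` (so a nonzero polynomial in `X` has absolute value `≥ 1`). -/
def absInf (f : Khat k) : ℝ :=
  if f = 0 then 0 else (Fintype.card k : ℝ) ^ (-f.order)

lemma absInf_nonneg (f : Khat k) : 0 ≤ absInf f := by
  unfold absInf
  split
  · exact le_refl 0
  · positivity

lemma absInf_eq_zero {f : Khat k} : absInf f = 0 ↔ f = 0 := by
  constructor
  · intro h
    by_contra hf
    have hq : (0:ℝ) < (Fintype.card k : ℝ) := by
      have := Fintype.card_pos (α := k); positivity
    rw [absInf, if_neg hf] at h
    exact absurd h (ne_of_gt (zpow_pos hq _))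
  · intro h; simp [absInf, h]

lemma absInf_neg (f : Khat k) : absInf (-f) = absInf f := by
  unfold absInf
  rw [neg_eq_zero, HahnSeries.order_neg]

lemma absInf_add_le (f g : Khat k) : absInf (f + g) ≤ max (absInf f) (absInf g) := by
  rcases eq_or_ne (f + g) 0 with h | h
  · rw [show absInf (f+g) = 0 by rw [absInf_eq_zero]; exact h]
    exact le_max_of_le_left (absInf_nonneg f)
  rcases eq_or_ne f 0 with hf | hf
  · simp [hf]
  rcases eq_or_ne g 0 with hg | hg
  · simp [hg]
  have hmin := HahnSeries.min_order_le_order_add h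
  have hq : (1:ℝ) ≤ (Fintype.card k : ℝ) := by
    exact_mod_cast Nat.one_le_iff_ne_zero.mpr Fintype.card_ne_zero
  rw [absInf, if_neg h]
  rcases le_total f.order g.order with hod | hod
  · rw [min_eq_left hod] at hmin
    refine le_max_of_le_left ?_
    rw [absInf, if_neg hf]
    exact zpow_le_zpow_right₀ hq (neg_le_neg hmin)
  · rw [min_eq_right hod] at hmin
    refine le_max_of_le_right ?_
    rw [absInf, if_neg hg]
    exact zpow_le_zpow_right₀ hq (neg_le_neg hmin)

/-- The metric `d_∞(f,g) = |f-g|_∞` on `K̂`. -/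
noncomputable instance : MetricSpace (Khat k) where
  dist f g := absInf (f - g)
  dist_self f := by simp [absInf]
  dist_comm f g := by
    have : g - f = -(f - g) := by ring
    show absInf (f - g) = absInf (g - f)
    rw [this, absInf_neg]
  dist_triangle f g h := by
    show absInf (f - h) ≤ absInf (f - g) + absInf (g - h)
    have key : absInf (f - h) ≤ max (absInf (f - g)) (absInf (g - h)) := by
      have : f - h = (f - g) + (g - h) := by ring
      rw [this]; exact absInf_add_le _ _
    exact key.trans (max_le_add_of_nonneg (absInf_nonneg _) (absInf_nonneg _))
  eq_of_dist_eq_zero := by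
    intro f g h
    have : f - g = 0 := absInf_eq_zero.mp h
    exact sub_eq_zero.mp this

/- Make sure the topology coming from the metric `d_∞` is the one used everywhere
(the valued-field uniformity on Laurent series induces the same topology). -/
instance (priority := 10000) : UniformSpace (Khat k) := PseudoMetricSpace.toUniformSpace
instance (priority := 10000) : TopologicalSpace (Khat k) := UniformSpace.toTopologicalSpace

instance : MeasurableSpace (Khat k) := borel _
instance : BorelSpace (Khat k) := ⟨rfl⟩

variable (k)

/-- The element `X⁻¹` of `K̂` (the uniformizer `t`). -/
def Xinv : Khat k := HahnSeries.single (1 : ℤ) (1 : k)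

/-- The element `X` of `K̂`. -/
def Xel : Khat k := HahnSeries.single (-1 : ℤ) (1 : k)

/-- The valuation ring `O = k[[X⁻¹]] = {f : |f|_∞ ≤ 1}`. -/
def Oball : Set (Khat k) := {f | absInf f ≤ 1}

/-- The set `X⁻¹O`, i.e. the maximal ideal of `O`. -/
def XinvO : Set (Khat k) := (fun f => Xinv k * f) '' Oball k

/-- The ring `A = k[X]` of polynomials in `X`, viewed as a subset of `K̂`. -/
def Aset : Set (Khat k) := Set.range fun p : Polynomial k => Polynomial.aeval (Xel k) p

/-- The constants `k ⊆ K̂`. -/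
def kconsts : Set (Khat k) := Set.range (algebraMap k (Khat k))

/-- The set `A∖k` of nonconstant polynomials in `X`, viewed inside `K̂`. -/
def AmK : Set (Khat k) := Aset k \ kconsts k

/-- The field `K = k(X)` of rational functions, viewed as a subset of `K̂`
(note that `k(X) = k(X⁻¹)` as a subfield of `K̂`). -/
def Kset : Set (Khat k) := Set.range fun r : RatFunc k => (r : LaurentSeries k)

/-- The set `ᶜK = K̂ ∖ K` of irrational elements. -/
def cK : Set (Khat k) := (Kset k)ᶜ

variable {k}

/-- The integer part `[f] ∈ A = k[X]` of `f ∈ K̂`: the sum of the terms of `f` with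
nonpositive exponents in `t = X⁻¹`. -/
def intPart (f : Khat k) : Khat k :=
  ∑ i ∈ Finset.Icc (min f.order 0) 0, HahnSeries.single i (f.coeff i)

/-- The fractional part `{f} = f - [f] ∈ X⁻¹O` of `f ∈ K̂`. -/
def fracPart (f : Khat k) : Khat k := f - intPart f

/-- The Artin map `Ψ(f) = 1/f - [1/f]`. -/
def ArtinPsi (f : Khat k) : Khat k := fracPart f⁻¹

/-- The Artin continued fraction digit `a_{n+1}(f) = [1/Ψⁿ(f)]` (for `n : ℕ`, so that
`digit 0 f = a₁(f) = [1/f]`). -/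
def digit (n : ℕ) (f : Khat k) : Khat k := intPart ((ArtinPsi (k := k))^[n] f)⁻¹

variable (k)

/-- The set `J = ⋃_{a ∈ A∖k} (a + X⁻¹O)`. -/
def Jset : Set (Khat k) := ⋃ a ∈ AmK k, (fun x => a + x) '' XinvO k

/-- The domain `Ω = (J ∩ ᶜK) × (X⁻¹O ∩ ᶜK)` of the natural extension of the Artin map. -/
def OmegaSet : Set (Khat k × Khat k) := (Jset k ∩ cK k) ×ˢ (XinvO k ∩ cK k)

variable {k}

/-- The map `Φ(ξ₋, ξ₊) = (1/ξ₋ - [1/ξ₊], Ψ(ξ₊))` (as a globally defined map on `K̂ × K̂`). -/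
def PhiRaw (p : Khat k × Khat k) : Khat k × Khat k :=
  (p.1⁻¹ - intPart p.2⁻¹, ArtinPsi p.2)

/-- The coding map `Θ'` sending `(ξ₋, ξ₊)` to the bilateral sequence `(c_n)_{n ∈ ℤ}` with
`c_n = a_n(ξ₊)` for `n ≥ 1` and `c_{-n} = a_{n+1}(-1/ξ₋)` for `n ≥ 0`. -/
def ThetaRaw (p : Khat k × Khat k) : ℤ → Khat k := fun n =>
  if 1 ≤ n then digit (n - 1).toNat p.2 else digit (-n).toNat (-p.1⁻¹)

variable (k)

/-- The density `q²/|ξ₊ - ξ₋|²_∞`. -/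
def dens (p : Khat k × Khat k) : ℝ≥0∞ :=
  ENNReal.ofReal ((Fintype.card k : ℝ) ^ 2 * ((absInf (p.2 - p.1)) ^ 2)⁻¹)

/-- The measure `m̂` on `Ω` given by `dm̂(ξ₋,ξ₊) = q² dμ(ξ₋) dμ(ξ₊)/|ξ₊ - ξ₋|²_∞`. -/
def mhat (μ : Measure (Khat k)) : Measure (Khat k × Khat k) :=
  (((μ.prod μ).withDensity (dens k))).restrict (OmegaSet k)

/-- The weight `ν(a) = |a|_∞⁻² = q^{-2 deg a}` for `a ∈ A∖k` (and `0` otherwise),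
with values in `ℝ≥0∞`. -/
def nuE (a : Khat k) : ℝ≥0∞ :=
  if a ∈ AmK k then ENNReal.ofReal (((absInf a) ^ 2)⁻¹) else 0

section Auxiliary

set_option linter.unusedSectionVars false

variable {k}

lemma one_lt_card : (1 : ℝ) < Fintype.card k := by
  exact_mod_cast Fintype.one_lt_card (α := k)

lemma card_pos' : (0 : ℝ) < Fintype.card k := zero_lt_one.trans one_lt_card

lemma absInf_of_ne_zero {f : Khat k} (hf : f ≠ 0) :
    absInf f = (Fintype.card k : ℝ) ^ (-f.order) := if_neg hf

lemma absInf_zero : absInf (0 : Khat k) = 0 := absInf_eq_zero.2 rfl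

lemma absInf_one : absInf (1 : Khat k) = 1 := by
  rw [absInf_of_ne_zero one_ne_zero, HahnSeries.order_one, neg_zero, zpow_zero]

lemma absInf_pos {f : Khat k} (hf : f ≠ 0) : 0 < absInf f :=
  (absInf_nonneg f).lt_of_ne fun h => hf (absInf_eq_zero.1 h.symm)

lemma absInf_mul (f g : Khat k) : absInf (f * g) = absInf f * absInf g := by
  rcases eq_or_ne f 0 with rfl | hf
  · simp [absInf_zero]
  rcases eq_or_ne g 0 with rfl | hg
  · simp [absInf_zero]
  rw [absInf_of_ne_zero hf, absInf_of_ne_zero hg, absInf_of_ne_zero (mul_ne_zero hf hg),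
    HahnSeries.order_mul hf hg, neg_add, zpow_add₀ card_pos'.ne']

lemma absInf_inv (f : Khat k) : absInf f⁻¹ = (absInf f)⁻¹ := by
  rcases eq_or_ne f 0 with rfl | hf
  · simp [absInf_zero]
  · exact eq_inv_of_mul_eq_one_left (by rw [← absInf_mul, inv_mul_cancel₀ hf, absInf_one])

lemma absInf_div (f g : Khat k) : absInf (f / g) = absInf f / absInf g := by
  rw [div_eq_mul_inv, absInf_mul, absInf_inv, div_eq_mul_inv]

lemma absInf_sub_comm (f g : Khat k) : absInf (f - g) = absInf (g - f) := by
  rw [← absInf_neg, neg_sub]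

lemma absInf_eq_of_sub_lt {x y : Khat k} (h : absInf (x - y) < absInf y) :
    absInf x = absInf y := by
  refine le_antisymm ?_ ?_
  · have := absInf_add_le (x - y) y
    rwa [sub_add_cancel, max_eq_right h.le] at this
  · have := absInf_add_le x (y - x)
    rw [add_sub_cancel, absInf_sub_comm y x] at this
    exact (le_max_iff.1 this).resolve_right h.not_ge

variable (k) in
/-- The closed ball `X⁻ⁿO` of radius `q⁻ⁿ` around `0`. -/
def fracIdeal (n : ℤ) : AddSubgroup (Khat k) where
  carrier := {f | ∀ i < n, f.coeff i = 0}
  add_mem' hf hg i hi := by simp [hf i hi, hg i hi]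
  zero_mem' := by simp
  neg_mem' hf i hi := by simp [hf i hi]

lemma mem_fracIdeal_iff_absInf_le {n : ℤ} {f : Khat k} :
    f ∈ fracIdeal k n ↔ absInf f ≤ (Fintype.card k : ℝ) ^ (-n) := by
  rcases eq_or_ne f 0 with rfl | hf
  · rw [absInf_zero]
    exact iff_of_true (zero_mem _) (zpow_nonneg card_pos'.le _)
  · rw [absInf_of_ne_zero hf, zpow_le_zpow_iff_right₀ one_lt_card, neg_le_neg_iff]
    refine ⟨fun h => le_of_not_gt fun hlt => ?_, fun h i hi => ?_⟩
    · exact hf (HahnSeries.coeff_order_eq_zero.1 (h _ hlt))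
    · exact HahnSeries.coeff_eq_zero_of_lt_order (hi.trans_le h)

lemma fracIdeal_anti {m n : ℤ} (h : m ≤ n) : fracIdeal k n ≤ fracIdeal k m :=
  fun _ hf i hi => hf i (hi.trans_le h)

lemma mem_fracIdeal_one_iff_absInf_lt {f : Khat k} : f ∈ fracIdeal k 1 ↔ absInf f < 1 := by
  rcases eq_or_ne f 0 with rfl | hf
  · rw [absInf_zero]
    exact iff_of_true (zero_mem _) one_pos
  · rw [mem_fracIdeal_iff_absInf_le, absInf_of_ne_zero hf, zpow_le_zpow_iff_right₀ one_lt_card,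
      zpow_lt_one_iff_right₀ one_lt_card]
    omega

lemma Oball_eq : Oball k = fracIdeal k 0 := by
  ext f
  simp [Oball, mem_fracIdeal_iff_absInf_le]

lemma absInf_Xinv : absInf (Xinv k) = (Fintype.card k : ℝ)⁻¹ := by
  have h : (HahnSeries.single (1 : ℤ) (1 : k)) ≠ 0 := by simp
  rw [Xinv, absInf_of_ne_zero h, HahnSeries.order_single one_ne_zero, zpow_neg_one]

lemma XinvO_eq : XinvO k = fracIdeal k 1 := by
  ext f
  have h0 : Xinv k ≠ 0 := by simp [Xinv]
  have hq := card_pos' (k := k)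
  rw [SetLike.mem_coe, mem_fracIdeal_iff_absInf_le, zpow_neg_one]
  constructor
  · rintro ⟨g, hg, rfl⟩
    simp only [absInf_mul, absInf_Xinv]
    exact mul_le_of_le_one_right (inv_nonneg.2 hq.le) hg
  · intro hf
    refine ⟨(Xinv k)⁻¹ * f, ?_, mul_inv_cancel_left₀ h0 f⟩
    simp only [Oball, Set.mem_ofPred_eq, absInf_mul, absInf_inv, absInf_Xinv, inv_inv]
    calc _ ≤ (Fintype.card k : ℝ) * (Fintype.card k : ℝ)⁻¹ := by gcongr
      _ = 1 := mul_inv_cancel₀ hq.ne'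

lemma coeff_intPart (f : Khat k) (i : ℤ) :
    (intPart f).coeff i = if i ≤ 0 then f.coeff i else 0 := by
  have h : ∀ j : ℤ, j ≠ i → (HahnSeries.single j (f.coeff j)).coeff i = 0 :=
    fun j hj => HahnSeries.coeff_single_of_ne hj.symm
  rw [intPart, HahnSeries.coeff_sum]
  split_ifs with h0
  · rw [Finset.sum_eq_single i (fun j _ => h j), HahnSeries.coeff_single_same]
    intro hi
    rw [HahnSeries.coeff_single_same]
    refine HahnSeries.coeff_eq_zero_of_lt_order (not_le.1 fun hle => hi ?_)
    exact Finset.mem_Icc.2 ⟨min_le_of_left_le hle, h0⟩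
  · refine Finset.sum_eq_zero fun j hj => h j fun hji => h0 ?_
    exact hji ▸ (Finset.mem_Icc.1 hj).2

lemma fracPart_mem (f : Khat k) : fracPart f ∈ fracIdeal k 1 := fun i hi => by
  rw [fracPart, HahnSeries.coeff_sub, coeff_intPart, if_pos (by omega), sub_self]

lemma intPart_eq_iff {f a : Khat k} (ha : intPart a = a) :
    intPart f = a ↔ f - a ∈ fracIdeal k 1 := by
  refine ⟨fun h => h ▸ fracPart_mem f, fun h => ?_⟩
  rw [← ha]
  ext i
  rw [coeff_intPart, coeff_intPart]
  split_ifs with hi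
  · have := h i (by omega)
    rwa [HahnSeries.coeff_sub, sub_eq_zero] at this
  · rfl

lemma intPart_intPart (f : Khat k) : intPart (intPart f) = intPart f := by
  ext i
  simp only [coeff_intPart]
  split_ifs <;> rfl

lemma intPart_eq_of_sub_mem {f g : Khat k} (h : f - g ∈ fracIdeal k 1) :
    intPart f = intPart g := by
  rw [intPart_eq_iff (intPart_intPart g)]
  have := add_mem h (fracPart_mem g)
  rwa [fracPart, sub_add_sub_cancel] at this

lemma algebraMap_mul_Xel_pow (c : k) (n : ℕ) :
    algebraMap k (Khat k) c * Xel k ^ n = HahnSeries.single (-n : ℤ) c := by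
  rw [LaurentSeries.algebraMap_apply, HahnSeries.C_apply, Xel, HahnSeries.single_pow,
    HahnSeries.single_mul_single]
  simp

lemma aeval_Xel_coeff_of_pos (p : Polynomial k) {i : ℤ} (hi : 0 < i) :
    (Polynomial.aeval (Xel k) p).coeff i = 0 := by
  rw [Polynomial.aeval_def, Polynomial.eval₂_eq_sum_range, HahnSeries.coeff_sum]
  refine Finset.sum_eq_zero fun n _ => ?_
  rw [algebraMap_mul_Xel_pow, HahnSeries.coeff_single_of_ne (by omega)]

lemma intPart_mem_Aset (f : Khat k) : intPart f ∈ Aset k := by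
  refine ⟨∑ i ∈ Finset.Icc (min f.order 0) 0, Polynomial.monomial (-i).toNat (f.coeff i), ?_⟩
  simp only [map_sum, Polynomial.aeval_monomial, intPart]
  refine Finset.sum_congr rfl fun i hi => ?_
  rw [algebraMap_mul_Xel_pow, Int.toNat_of_nonneg (by simp at hi; omega), neg_neg]

lemma intPart_eq_self_of_mem_Aset {f : Khat k} (hf : f ∈ Aset k) : intPart f = f := by
  obtain ⟨p, rfl⟩ := hf
  ext i
  rw [coeff_intPart]
  split_ifs with hi
  · rfl
  · exact (aeval_Xel_coeff_of_pos p (not_le.1 hi)).symm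

lemma mem_AmK_iff {f : Khat k} : f ∈ AmK k ↔ intPart f = f ∧ f ∉ fracIdeal k 0 := by
  refine and_congr ⟨intPart_eq_self_of_mem_Aset, fun h => h ▸ intPart_mem_Aset f⟩ Iff.rfl
    |>.trans (and_congr_right fun h => not_congr ⟨?_, fun h0 => ⟨f.coeff 0, ?_⟩⟩)
  · rintro ⟨c, rfl⟩ i hi
    rw [LaurentSeries.algebraMap_apply, HahnSeries.C_apply]
    simp [hi.ne]
  · ext i
    rw [LaurentSeries.algebraMap_apply, HahnSeries.C_apply]
    rcases lt_trichotomy i 0 with hi | rfl | hi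
    · simp [hi.ne, h0 i hi]
    · simp
    · rw [HahnSeries.coeff_single_of_ne hi.ne', ← h, coeff_intPart, if_neg hi.not_ge]

lemma intPart_eq_self {a : Khat k} (ha : a ∈ AmK k) : intPart a = a := (mem_AmK_iff.1 ha).1

lemma intPart_mem_AmK {f : Khat k} (hf : f ∉ fracIdeal k 0) : intPart f ∈ AmK k := by
  refine mem_AmK_iff.2 ⟨intPart_intPart f, fun h => hf ?_⟩
  have := add_mem h (fracIdeal_anti zero_le_one (fracPart_mem f))
  rwa [fracPart, add_sub_cancel] at this

lemma one_lt_absInf {f : Khat k} (hf : f ∉ fracIdeal k 0) : 1 < absInf f := by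
  simpa [mem_fracIdeal_iff_absInf_le] using hf

lemma Jset_eq : Jset k = {f | f ∉ fracIdeal k 0} := by
  ext f
  simp only [Jset, Set.mem_iUnion, Set.mem_image, XinvO_eq, exists_prop, Set.mem_ofPred_eq,
    SetLike.mem_coe]
  constructor
  · rintro ⟨a, ha, x, hx, rfl⟩ h
    refine (mem_AmK_iff.1 ha).2 ?_
    simpa using sub_mem h (fracIdeal_anti zero_le_one hx)
  · exact fun h => ⟨_, intPart_mem_AmK h, _, fracPart_mem f, by simp [fracPart]⟩

lemma div_sub_mem_fracIdeal_iff {ε w η : Khat k} {m n : ℤ} (hε : absInf ε = 1)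
    (hw : absInf w = (Fintype.card k : ℝ) ^ m) (hmn : -n < m) :
    ε / η - w ∈ fracIdeal k n ↔ η - ε / w ∈ fracIdeal k (n + 2 * m) := by
  have hq := card_pos' (k := k)
  have hw0 : w ≠ 0 := fun h => (zpow_pos hq m).ne (by rw [← hw, h, absInf_zero])
  have key : absInf η = (Fintype.card k : ℝ) ^ (-m) →
      (ε / η - w ∈ fracIdeal k n ↔ η - ε / w ∈ fracIdeal k (n + 2 * m)) := by
    intro hη
    have hη0 : η ≠ 0 := fun h => (zpow_pos hq (-m)).ne (by rw [← hη, h, absInf_zero])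
    have : η - ε / w = -(η / w * (ε / η - w)) := by field_simp; ring
    rw [mem_fracIdeal_iff_absInf_le, mem_fracIdeal_iff_absInf_le, this, absInf_neg, absInf_mul,
      absInf_div, hη, hw, ← zpow_sub₀ hq.ne',
      show -(n + 2 * m) = (-m - m) + -n by ring, zpow_add₀ hq.ne' (-m - m)]
    exact (mul_le_mul_iff_right₀ (zpow_pos hq _)).symm
  constructor
  · intro h
    refine (key ?_).1 h
    have h1 : absInf (ε / η) = absInf w := absInf_eq_of_sub_lt <|
      (mem_fracIdeal_iff_absInf_le.1 h).trans_lt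
        (by rw [hw]; exact zpow_lt_zpow_right₀ one_lt_card hmn)
    rw [absInf_div, hε, hw, one_div] at h1
    rw [zpow_neg, ← h1, inv_inv]
  · intro h
    refine (key ?_).2 h
    have h2 : absInf (ε / w) = (Fintype.card k : ℝ) ^ (-m) := by
      rw [absInf_div, hε, hw, zpow_neg, one_div]
    rw [← h2]
    refine absInf_eq_of_sub_lt ((mem_fracIdeal_iff_absInf_le.1 h).trans_lt ?_)
    rw [h2]
    exact zpow_lt_zpow_right₀ one_lt_card (by omega)

/-- The closed ball `b + X⁻ⁿO`. -/
def fracBall (b : Khat k) (n : ℤ) : Set (Khat k) := {x | x - b ∈ fracIdeal k n}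

lemma mem_fracBall {b x : Khat k} {n : ℤ} : x ∈ fracBall b n ↔ x - b ∈ fracIdeal k n := Iff.rfl

lemma dist_eq_absInf (f g : Khat k) : dist f g = absInf (f - g) := rfl

lemma fracBall_zero (n : ℤ) : fracBall (0 : Khat k) n = fracIdeal k n := by
  ext x
  simp [mem_fracBall]

lemma mem_fracBall_self (b : Khat k) (n : ℤ) : b ∈ fracBall b n := by
  rw [mem_fracBall, sub_self]
  exact zero_mem _

lemma fracBall_subset {b c : Khat k} {m n : ℤ} (hmn : m ≤ n) (h : b ∈ fracBall c m) :
    fracBall b n ⊆ fracBall c m := fun x hx => by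
  have := add_mem (fracIdeal_anti hmn hx) h
  rwa [sub_add_sub_cancel] at this

lemma mem_fracBall_comm {b c : Khat k} {n : ℤ} : b ∈ fracBall c n ↔ c ∈ fracBall b n := by
  rw [mem_fracBall, mem_fracBall, ← neg_mem_iff, neg_sub]

lemma isOpen_fracBall (b : Khat k) (n : ℤ) : IsOpen (fracBall b n) := by
  refine Metric.isOpen_iff.2 fun x hx => ⟨_, zpow_pos (card_pos' (k := k)) (-n), fun y hy => ?_⟩
  refine fracBall_subset le_rfl hx ?_
  rw [mem_fracBall, mem_fracIdeal_iff_absInf_le]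
  exact (Metric.mem_ball.1 hy).le

lemma measurableSet_fracBall (b : Khat k) (n : ℤ) : MeasurableSet (fracBall b n) :=
  (isOpen_fracBall b n).measurableSet

lemma measurableSet_fracIdeal (n : ℤ) : MeasurableSet (fracIdeal k n : Set (Khat k)) :=
  fracBall_zero (k := k) n ▸ measurableSet_fracBall _ _

lemma exists_fracBall_subset (x : Khat k) {ε : ℝ} (hε : 0 < ε) :
    ∃ n : ℕ, fracBall x (n + 1) ⊆ Metric.ball x ε := by
  obtain ⟨n, hn⟩ := exists_pow_lt_of_lt_one hε (inv_lt_one_of_one_lt₀ (one_lt_card (k := k)))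
  refine ⟨n, fun y hy => ?_⟩
  have := mem_fracIdeal_iff_absInf_le.1 (fracIdeal_anti (by omega : (n : ℤ) ≤ n + 1) hy)
  rw [zpow_neg, zpow_natCast, ← inv_pow] at this
  exact this.trans_lt hn

variable (k) in
lemma isTopologicalBasis_fracBall : TopologicalSpace.IsTopologicalBasis
    {s : Set (Khat k) | ∃ (b : Khat k) (n : ℤ), 1 ≤ n ∧ s = fracBall b n} := by
  refine TopologicalSpace.isTopologicalBasis_of_isOpen_of_nhds ?_ fun x u hx hu => ?_
  · rintro _ ⟨b, n, -, rfl⟩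
    exact isOpen_fracBall b n
  · obtain ⟨ε, hε, hu'⟩ := Metric.isOpen_iff.1 hu x hx
    obtain ⟨n, hn⟩ := exists_fracBall_subset x hε
    exact ⟨_, ⟨x, n + 1, by omega, rfl⟩, mem_fracBall_self x _, hn.trans hu'⟩

lemma isPiSystem_fracBall :
    IsPiSystem {s : Set (Khat k) | ∃ (b : Khat k) (n : ℤ), 1 ≤ n ∧ s = fracBall b n} := by
  rintro _ ⟨b, m, hm, rfl⟩ _ ⟨c, n, hn, rfl⟩ ⟨x, hxb, hxc⟩
  refine ⟨x, max m n, le_max_of_le_left hm, Set.Subset.antisymm (fun y hy => ?_) ?_⟩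
  · rcases max_choice m n with h | h <;> rw [h]
    · exact fracBall_subset le_rfl (mem_fracBall_comm.1 hxb) hy.1
    · exact fracBall_subset le_rfl (mem_fracBall_comm.1 hxc) hy.2
  · exact Set.subset_inter (fracBall_subset (le_max_left m n) hxb)
      (fracBall_subset (le_max_right m n) hxc)

variable (k) in
lemma countable_finite_support : {f : Khat k | f.support.Finite}.Countable := by
  rw [← Set.countable_coe_iff]
  refine Function.Injective.countable
    (f := fun f : {f : Khat k | f.support.Finite} => Finsupp.ofSupportFinite f.1.coeff f.2) ?_
  intro f g h
  ext i
  exact DFunLike.congr_fun h i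

lemma support_truncLT_finite (n : ℤ) (f : Khat k) : (HahnSeries.truncLT n f).support.Finite := by
  refine (Set.finite_Icc f.order n).subset fun i hi => ?_
  rw [HahnSeries.support_truncLT] at hi
  exact ⟨HahnSeries.order_le_of_coeff_ne_zero hi.1, hi.2.le⟩

lemma mem_fracBall_truncLT (n : ℤ) (f : Khat k) : f ∈ fracBall (HahnSeries.truncLT n f) n :=
  fun i hi => by rw [HahnSeries.coeff_sub, HahnSeries.coeff_truncLT, if_pos hi, sub_self]

instance : SecondCountableTopology (Khat k) := by
  have : TopologicalSpace.SeparableSpace (Khat k) := by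
    refine ⟨_, countable_finite_support k, fun f => Metric.mem_closure_iff.2 fun ε hε => ?_⟩
    obtain ⟨n, hn⟩ := exists_fracBall_subset f hε
    exact ⟨_, support_truncLT_finite (n + 1) f,
      Metric.mem_ball'.1 (hn (mem_fracBall_comm.1 (mem_fracBall_truncLT _ f)))⟩
  exact UniformSpace.secondCountable_of_separable _

variable (k) in
lemma countable_AmK : (AmK k).Countable := by
  refine (countable_finite_support k).mono fun f hf => ?_
  refine (Set.finite_Icc f.order 0).subset fun i hi => ⟨HahnSeries.order_le_of_coeff_ne_zero hi, ?_⟩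
  by_contra h
  refine hi ?_
  rw [← intPart_eq_self hf, coeff_intPart, if_neg h]

variable (k) in
lemma countable_Kset : (Kset k).Countable := by
  have h1 : Countable (Polynomial k) := by
    refine Function.Injective.countable (f := fun p : Polynomial k =>
      Finsupp.onFinset p.support p.coeff fun _ => Polynomial.mem_support_iff.2) fun p q h => ?_
    exact Polynomial.ext fun i => DFunLike.congr_fun h i
  have h2 : Countable (RatFunc k) := by
    refine Function.Injective.countable (f := fun r : RatFunc k => (r.num, r.denom)) ?_
    intro r s h
    obtain ⟨hn, hd⟩ := Prod.ext_iff.1 h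
    dsimp only at hn hd
    rw [← RatFunc.num_div_denom r, ← RatFunc.num_div_denom s, hn, hd]
  exact Set.countable_range _

lemma continuous_intPart : Continuous (intPart (k := k)) := by
  refine Metric.continuous_iff.2 fun f ε hε => ⟨1, one_pos, fun g hg => ?_⟩
  rw [intPart_eq_of_sub_mem (mem_fracIdeal_one_iff_absInf_lt.2 hg), dist_self]
  exact hε

lemma isometry_add_left (a : Khat k) : Isometry fun x => a + x :=
  Isometry.of_dist_eq fun x y => by simp [dist_eq_absInf]

lemma isometry_neg : Isometry fun x : Khat k => -x :=
  Isometry.of_dist_eq fun x y => by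
    rw [dist_eq_absInf, dist_eq_absInf, neg_sub_neg, absInf_sub_comm]

lemma measurable_add_left (a : Khat k) : Measurable fun x => a + x :=
  (isometry_add_left a).continuous.measurable

lemma measurable_intPart : Measurable (intPart (k := k)) := continuous_intPart.measurable

lemma measurable_fracPart : Measurable (fracPart (k := k)) := by
  refine Continuous.measurable (Metric.continuous_iff.2 fun f ε hε => ?_)
  refine ⟨min 1 ε, lt_min one_pos hε, fun g hg => ?_⟩
  have h1 := intPart_eq_of_sub_mem (mem_fracIdeal_one_iff_absInf_lt.2 (hg.trans_le (min_le_left _ _)))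
  rw [dist_eq_absInf, fracPart, fracPart, h1, sub_sub_sub_cancel_right]
  exact hg.trans_le (min_le_right _ _)

lemma measurable_inv_Khat : Measurable fun x : Khat k => x⁻¹ := by
  refine measurable_of_continuousOn_compl_singleton 0 fun f hf => ?_
  refine ContinuousAt.continuousWithinAt (Metric.continuousAt_iff.2 fun ε hε => ?_)
  have hf0 : 0 < absInf f := absInf_pos hf
  refine ⟨min (absInf f) (ε * absInf f ^ 2), lt_min hf0 (by positivity), fun g hg => ?_⟩
  have hgf : absInf g = absInf f := absInf_eq_of_sub_lt (hg.trans_le (min_le_left _ _))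
  have hg0 : g ≠ 0 := fun h => hf0.ne (by rw [← hgf, h, absInf_zero])
  have hlt := hg.trans_le (min_le_right _ _)
  rw [dist_eq_absInf] at hlt ⊢
  rw [inv_sub_inv hg0 hf, absInf_div, absInf_mul, hgf, absInf_sub_comm, ← sq,
    div_lt_iff₀ (by positivity)]
  exact hlt

lemma measurable_digit (n : ℕ) : Measurable (digit (k := k) n) :=
  measurable_intPart.comp (measurable_inv_Khat.comp
    ((measurable_fracPart.comp measurable_inv_Khat).iterate n))

lemma measurable_absInf : Measurable (absInf (k := k)) := by
  have : (absInf (k := k)) = fun f => dist f 0 := by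
    funext f
    rw [dist_eq_absInf, sub_zero]
  rw [this]
  exact (continuous_id.dist continuous_const).measurable

/-- `μ` is the Haar measure on `K̂` normalized by `μ(O) = 1`. -/
structure IsNormalizedHaar (μ : Measure (Khat k)) : Prop where
  map_add_left : ∀ x : Khat k, μ.map (fun y => x + y) = μ
  measure_Oball : μ (Oball k) = 1

namespace IsNormalizedHaar

variable {μ : Measure (Khat k)}

lemma measure_preimage_add (hμ : IsNormalizedHaar μ) (a : Khat k) {s : Set (Khat k)}
    (hs : MeasurableSet s) : μ ((fun x => a + x) ⁻¹' s) = μ s := by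
  rw [← Measure.map_apply (measurable_add_left a) hs, hμ.map_add_left]

lemma measure_fracBall (hμ : IsNormalizedHaar μ) (b : Khat k) (n : ℤ) :
    μ (fracBall b n) = μ (fracIdeal k n) := by
  rw [← hμ.measure_preimage_add (-b) (measurableSet_fracIdeal n)]
  congr 1
  ext x
  simp [mem_fracBall, sub_eq_neg_add]

lemma measure_fracIdeal_succ (hμ : IsNormalizedHaar μ) (n : ℤ) :
    μ (fracIdeal k n) = Fintype.card k * μ (fracIdeal k (n + 1)) := by
  have h : (fracIdeal k n : Set (Khat k)) =
      ⋃ c : k, fracBall (HahnSeries.single n c) (n + 1) := by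
    ext f
    simp only [Set.mem_iUnion, SetLike.mem_coe, mem_fracBall]
    constructor
    · intro hf
      refine ⟨f.coeff n, fun i hi => ?_⟩
      rw [HahnSeries.coeff_sub]
      rcases (Int.lt_add_one_iff.1 hi).lt_or_eq with h | rfl
      · rw [hf i h, HahnSeries.coeff_single_of_ne h.ne, sub_self]
      · rw [HahnSeries.coeff_single_same, sub_self]
    · rintro ⟨c, hc⟩ i hi
      have := hc i (by omega)
      rwa [HahnSeries.coeff_sub, HahnSeries.coeff_single_of_ne hi.ne, sub_zero] at this
  rw [h, measure_iUnion _ fun c => measurableSet_fracBall _ _]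
  · simp [hμ.measure_fracBall, tsum_fintype]
  · intro c d hcd
    refine Set.disjoint_left.2 fun f hc hd => hcd ?_
    have h1 := hc n (by omega)
    have h2 := hd n (by omega)
    rw [HahnSeries.coeff_sub, HahnSeries.coeff_single_same, sub_eq_zero] at h1 h2
    rw [← h1, ← h2]

lemma measure_fracIdeal_add (hμ : IsNormalizedHaar μ) (n : ℤ) (j : ℕ) :
    μ (fracIdeal k n) = (Fintype.card k : ℝ≥0∞) ^ j * μ (fracIdeal k (n + j)) := by
  induction j with
  | zero => simp
  | succ j ih =>
    rw [ih, hμ.measure_fracIdeal_succ, pow_succ, mul_assoc, Nat.cast_succ, add_assoc]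

lemma measure_fracIdeal_zero (hμ : IsNormalizedHaar μ) : μ (fracIdeal k 0) = 1 :=
  Oball_eq (k := k) ▸ hμ.measure_Oball

lemma card_mul_measure_fracIdeal_one (hμ : IsNormalizedHaar μ) :
    Fintype.card k * μ (fracIdeal k 1) = 1 := by
  rw [← hμ.measure_fracIdeal_zero, hμ.measure_fracIdeal_succ 0, zero_add]

lemma measure_fracIdeal_one_ne_top (hμ : IsNormalizedHaar μ) : μ (fracIdeal k 1) ≠ ∞ :=
  ne_top_of_le_ne_top (hμ.measure_fracIdeal_zero ▸ ENNReal.one_ne_top)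
    (measure_mono (fracIdeal_anti zero_le_one))

lemma sigmaFinite (hμ : IsNormalizedHaar μ) : SigmaFinite μ := by
  refine Measure.sigmaFinite_of_countable
    (S := (fun b => fracBall b 0) '' {f : Khat k | f.support.Finite})
    ((countable_finite_support k).image _) ?_ ?_
  · rintro _ ⟨b, -, rfl⟩
    simp [hμ.measure_fracBall, hμ.measure_fracIdeal_zero]
  · refine Set.sUnion_eq_univ_iff.2 fun f => ?_
    exact ⟨_, ⟨_, support_truncLT_finite 0 f, rfl⟩, mem_fracBall_truncLT 0 f⟩

lemma measure_singleton (hμ : IsNormalizedHaar μ) (x : Khat k) : μ {x} = 0 := by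
  have hlt : (Fintype.card k : ℝ≥0∞)⁻¹ < 1 := by
    rw [ENNReal.inv_lt_one]
    exact_mod_cast Fintype.one_lt_card (α := k)
  refine le_antisymm (ge_of_tendsto' (ENNReal.tendsto_pow_atTop_nhds_zero_of_lt_one hlt)
    fun n => ?_) zero_le
  rw [← ENNReal.inv_pow, ← one_div, ENNReal.le_div_iff_mul_le (by simp) (by simp), mul_comm,
    ← hμ.measure_fracIdeal_zero, hμ.measure_fracIdeal_add 0 n, zero_add,
    ← hμ.measure_fracBall x n]
  gcongr
  exact Set.singleton_subset_iff.2 (mem_fracBall_self x n)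

end IsNormalizedHaar

lemma measure_eq_of_fracBall_eq {ν₁ ν₂ : Measure (Khat k)} (hfin : ν₁ (fracIdeal k 1) ≠ ∞)
    (h : ∀ b ∈ fracIdeal k 1, ∀ n : ℤ, 1 ≤ n → ν₁ (fracBall b n) = ν₂ (fracBall b n))
    {B : Set (Khat k)} (hBs : B ⊆ fracIdeal k 1) : ν₁ B = ν₂ B := by
  have : Fact (ν₁ (fracIdeal k 1) < ∞) := ⟨hfin.lt_top⟩
  have key : ν₁.restrict (fracIdeal k 1) = ν₂.restrict (fracIdeal k 1) := by
    refine ext_of_generate_finite _ ?_ isPiSystem_fracBall ?_ ?_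
    · rw [BorelSpace.measurable_eq (α := Khat k)]
      exact (isTopologicalBasis_fracBall k).borel_eq_generateFrom
    · rintro _ ⟨b, n, hn, rfl⟩
      rw [Measure.restrict_apply (measurableSet_fracBall b n),
        Measure.restrict_apply (measurableSet_fracBall b n)]
      by_cases hb : b ∈ fracIdeal k 1
      · have hsub : fracBall b n ⊆ fracIdeal k 1 := by
          rw [← SetLike.mem_coe, ← fracBall_zero] at hb
          rw [← fracBall_zero]
          exact fracBall_subset hn hb
        rw [Set.inter_eq_left.2 hsub]
        exact h b hb n hn
      · have : fracBall b n ∩ fracIdeal k 1 = ∅ := by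
          refine Set.eq_empty_of_forall_notMem fun x hx => hb ?_
          simpa using sub_mem hx.2 (fracIdeal_anti hn hx.1)
        rw [this, measure_empty, measure_empty]
    · simpa [fracBall_zero] using h 0 (zero_mem _) 1 le_rfl
  rw [← Measure.restrict_eq_self ν₁ hBs, key, Measure.restrict_eq_self ν₂ hBs]

lemma measurable_div_sub (ε a : Khat k) (hε : absInf ε = 1) :
    Measurable fun η : Khat k => ε / η - a := by
  have hmul : Isometry fun x : Khat k => ε * x := Isometry.of_dist_eq fun x y => by
    rw [dist_eq_absInf, dist_eq_absInf, ← mul_sub, absInf_mul, hε, one_mul]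
  have := (measurable_add_left (-a)).comp (hmul.continuous.measurable.comp measurable_inv_Khat)
  refine (congrArg Measurable (funext fun η => ?_)).mp this
  simp [div_eq_mul_inv, sub_eq_neg_add]

/-- The maps `η ↦ ε / η - a` contract the Haar measure of subsets of `X⁻¹O` by `|a|²`. -/
lemma IsNormalizedHaar.measure_preimage_div_sub {μ : Measure (Khat k)} (hμ : IsNormalizedHaar μ)
    {ε a : Khat k} (hε : absInf ε = 1) (ha : a ∉ fracIdeal k 0) {B : Set (Khat k)}
    (hB : MeasurableSet B) (hBs : B ⊆ fracIdeal k 1) :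
    μ ((fun η => ε / η - a) ⁻¹' B) = ENNReal.ofReal ((absInf a ^ 2)⁻¹) * μ B := by
  have hg := measurable_div_sub ε a hε
  have hq := card_pos' (k := k)
  obtain ⟨m, hm, ham⟩ : ∃ m : ℕ, 0 < m ∧ absInf a = (Fintype.card k : ℝ) ^ (m : ℤ) := by
    have h1 := one_lt_absInf ha
    have ha0 : a ≠ 0 := fun h => ha (h ▸ zero_mem _)
    rw [absInf_of_ne_zero ha0, one_lt_zpow_iff_right₀ one_lt_card] at h1
    refine ⟨(-a.order).toNat, by omega, ?_⟩
    rw [Int.toNat_of_nonneg h1.le, absInf_of_ne_zero ha0]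
  have hc : ENNReal.ofReal ((absInf a ^ 2)⁻¹) * (Fintype.card k : ℝ≥0∞) ^ (2 * m) = 1 := by
    rw [ENNReal.ofReal_inv_of_pos (by rw [ham]; positivity), ham, zpow_natCast, ← pow_mul,
      mul_comm m, ENNReal.ofReal_pow hq.le, ENNReal.ofReal_natCast]
    exact ENNReal.inv_mul_cancel (by simp) (by simp)
  rw [← Measure.map_apply hg hB, ← smul_eq_mul, ← Measure.smul_apply]
  have hball : ∀ b ∈ fracIdeal k 1, ∀ n : ℤ, 1 ≤ n →
      (μ.map fun η => ε / η - a) (fracBall b n) =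
        (ENNReal.ofReal ((absInf a ^ 2)⁻¹) • μ) (fracBall b n) := by
    intro b hb n hn
    have hab : absInf (a + b) = (Fintype.card k : ℝ) ^ (m : ℤ) := by
      rw [← ham]
      refine absInf_eq_of_sub_lt ?_
      rw [add_sub_cancel_left]
      exact (mem_fracIdeal_one_iff_absInf_lt.1 hb).trans (one_lt_absInf ha)
    have hpre : (fun η => ε / η - a) ⁻¹' fracBall b n = fracBall (ε / (a + b)) (n + 2 * m) := by
      ext η
      rw [Set.mem_preimage, mem_fracBall, mem_fracBall, sub_sub]
      exact div_sub_mem_fracIdeal_iff hε hab (by omega)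
    rw [Measure.map_apply hg (measurableSet_fracBall b n), hpre, Measure.smul_apply, smul_eq_mul,
      hμ.measure_fracBall, hμ.measure_fracBall, hμ.measure_fracIdeal_add n (2 * m), ← mul_assoc,
      hc, one_mul, Nat.cast_mul, Nat.cast_two]
  refine measure_eq_of_fracBall_eq ?_ hball hBs
  have := hball 0 (zero_mem _) 1 le_rfl
  rw [fracBall_zero] at this
  rw [this, Measure.smul_apply, smul_eq_mul]
  exact ENNReal.mul_ne_top ENNReal.ofReal_ne_top hμ.measure_fracIdeal_one_ne_top

lemma measure_eq_tsum_fiber {α : Type*} [MeasurableSpace α] {ν : Measure α} {h : α → Khat k}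
    (hh : Measurable h) (h0 : ν {x | h x ∉ AmK k} = 0) {E : Set α} (hE : MeasurableSet E) :
    ν E = ∑' a : AmK k, ν (E ∩ {x | h x = a}) := by
  have : Countable (AmK k) := (countable_AmK k).to_subtype
  rw [← measure_iUnion]
  · refine le_antisymm ?_ (measure_mono (Set.iUnion_subset fun _ => Set.inter_subset_left))
    calc ν E ≤ ν ((⋃ a : AmK k, E ∩ {x | h x = a}) ∪ {x | h x ∉ AmK k}) := by
          refine measure_mono fun x hx => ?_
          by_cases hxa : h x ∈ AmK k
          · exact Or.inl (Set.mem_iUnion.2 ⟨⟨h x, hxa⟩, hx, rfl⟩)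
          · exact Or.inr hxa
      _ ≤ _ := (measure_union_le _ _).trans (by rw [h0, add_zero])
  · intro a b hab
    refine Set.disjoint_left.2 fun x hxa hxb => hab (Subtype.ext ?_)
    rw [← hxa.2, ← hxb.2]
  · exact fun a => hE.inter (hh (measurableSet_singleton _))

/-- The Haar measure on `X⁻¹O`, normalized to a probability measure. -/
def fracMeasure (μ : Measure (Khat k)) : Measure (Khat k) :=
  (Fintype.card k : ℝ≥0∞) • μ.restrict (fracIdeal k 1)

lemma fracMeasure_apply (μ : Measure (Khat k)) {s : Set (Khat k)} (hs : MeasurableSet s) :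
    fracMeasure μ s = Fintype.card k * μ (s ∩ fracIdeal k 1) := by
  rw [fracMeasure, Measure.smul_apply, smul_eq_mul, Measure.restrict_apply hs]

lemma measurable_div (ε : Khat k) (hε : absInf ε = 1) : Measurable fun x : Khat k => ε / x := by
  simpa using measurable_div_sub ε 0 hε

lemma measurable_ArtinPsi : Measurable (ArtinPsi (k := k)) :=
  measurable_fracPart.comp measurable_inv_Khat

lemma nuE_of_mem {a : Khat k} (ha : a ∈ AmK k) :
    nuE k a = ENNReal.ofReal ((absInf a ^ 2)⁻¹) := if_pos ha

namespace IsNormalizedHaar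

variable {μ : Measure (Khat k)}

lemma fracMeasure_univ (hμ : IsNormalizedHaar μ) : fracMeasure μ Set.univ = 1 := by
  rw [fracMeasure_apply μ MeasurableSet.univ, Set.univ_inter, hμ.card_mul_measure_fracIdeal_one]

lemma fracMeasure_intPart_div_notMem (hμ : IsNormalizedHaar μ) {ε : Khat k} (hε : absInf ε = 1) :
    fracMeasure μ {x | intPart (ε / x) ∉ AmK k} = 0 := by
  have hm : MeasurableSet {x | intPart (ε / x) ∉ AmK k} :=
    (measurable_intPart.comp (measurable_div ε hε)) (countable_AmK k).measurableSet.compl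
  rw [fracMeasure_apply μ hm]
  refine mul_eq_zero.2 (Or.inr (measure_mono_null (fun x hx => ?_) (hμ.measure_singleton 0)))
  by_contra hx0
  refine hx.1 (intPart_mem_AmK ?_)
  rw [mem_fracIdeal_iff_absInf_le, absInf_div, hε, neg_zero, zpow_zero, not_le]
  exact (one_lt_div (absInf_pos hx0)).2 (mem_fracIdeal_one_iff_absInf_lt.1 hx.2)

lemma fracMeasure_fiber (hμ : IsNormalizedHaar μ) {ε a : Khat k} (hε : absInf ε = 1)
    (ha : a ∈ AmK k) {E : Set (Khat k)} (hE : MeasurableSet E) :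
    fracMeasure μ (E ∩ {x | intPart (ε / x) = a}) =
      nuE k a * fracMeasure μ {x | ε / (a + x) ∈ E} := by
  have hE' : MeasurableSet {x | ε / (a + x) ∈ E} :=
    ((measurable_div ε hε).comp (measurable_add_left a)) hE
  have hε0 : ε ≠ 0 := fun h => zero_ne_one (by rw [← hε, h, absInf_zero])
  have ha0 := (mem_AmK_iff.1 ha).2
  have hpre : E ∩ {x | intPart (ε / x) = a} ∩ fracIdeal k 1 =
      (fun η => ε / η - a) ⁻¹' ({x | ε / (a + x) ∈ E} ∩ fracIdeal k 1) := by
    ext η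
    simp only [Set.mem_inter_iff, Set.mem_ofPred_eq, Set.mem_preimage, SetLike.mem_coe,
      add_sub_cancel, div_div_cancel₀ hε0, intPart_eq_iff (intPart_eq_self ha)]
    refine ⟨fun h => h.1, fun h => ⟨h, ?_⟩⟩
    have h1 : absInf (ε / η) = absInf a := absInf_eq_of_sub_lt
      ((mem_fracIdeal_one_iff_absInf_lt.1 h.2).trans (one_lt_absInf ha0))
    rw [absInf_div, hε, one_div] at h1
    rw [mem_fracIdeal_one_iff_absInf_lt, ← inv_inv (absInf η), h1]
    exact inv_lt_one_of_one_lt₀ (one_lt_absInf ha0)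
  have hm : MeasurableSet {x | intPart (ε / x) = a} :=
    (measurable_intPart.comp (measurable_div ε hε)) (measurableSet_singleton a)
  rw [fracMeasure_apply μ hE', fracMeasure_apply μ (hE.inter hm), hpre,
    hμ.measure_preimage_div_sub hε ha0 (hE'.inter (measurableSet_fracIdeal 1))
      Set.inter_subset_right, nuE_of_mem ha, mul_left_comm]

lemma fracMeasure_ArtinPsi_fiber (hμ : IsNormalizedHaar μ) {a : Khat k} (ha : a ∈ AmK k)
    {B : Set (Khat k)} (hB : MeasurableSet B) :
    fracMeasure μ (ArtinPsi ⁻¹' B ∩ {x | digit 0 x = a}) = nuE k a * fracMeasure μ B := by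
  have h := hμ.fracMeasure_fiber absInf_one ha (measurable_ArtinPsi hB)
  simp only [one_div] at h
  refine h.trans ?_
  have hm : MeasurableSet {x | (a + x)⁻¹ ∈ ArtinPsi ⁻¹' B} :=
    (measurable_inv_Khat.comp (measurable_add_left a)) (measurable_ArtinPsi hB)
  rw [fracMeasure_apply μ hm, fracMeasure_apply μ hB]
  congr 3
  ext x
  refine and_congr_left fun hx => ?_
  have : intPart (a + x) = a := (intPart_eq_iff (intPart_eq_self ha)).2 (by simpa using hx)
  simp [ArtinPsi, fracPart, this]

lemma fracMeasure_digit_zero_notMem (hμ : IsNormalizedHaar μ) :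
    fracMeasure μ {x | digit 0 x ∉ AmK k} = 0 := by
  simpa [digit] using hμ.fracMeasure_intPart_div_notMem absInf_one

lemma fracMeasure_digit_zero (hμ : IsNormalizedHaar μ) (a : Khat k) :
    fracMeasure μ (digit 0 ⁻¹' {a}) = nuE k a := by
  by_cases ha : a ∈ AmK k
  · have := hμ.fracMeasure_ArtinPsi_fiber ha MeasurableSet.univ
    rwa [hμ.fracMeasure_univ, mul_one, Set.preimage_univ, Set.univ_inter] at this
  · rw [nuE, if_neg ha]
    refine measure_mono_null (fun x hx => ?_) hμ.fracMeasure_digit_zero_notMem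
    rw [Set.mem_preimage, Set.mem_singleton_iff] at hx
    rwa [Set.mem_ofPred_eq, hx]

lemma fracMeasure_digit_zero_inter (hμ : IsNormalizedHaar μ) {s B : Set (Khat k)}
    (hs : MeasurableSet s) (hB : MeasurableSet B) :
    fracMeasure μ (digit 0 ⁻¹' s ∩ ArtinPsi ⁻¹' B) =
      fracMeasure μ (digit 0 ⁻¹' s) * fracMeasure μ B := by
  have key : ∀ C : Set (Khat k), MeasurableSet C →
      fracMeasure μ (digit 0 ⁻¹' s ∩ ArtinPsi ⁻¹' C) =
        (∑' a : AmK k, if (a : Khat k) ∈ s then nuE k a else 0) * fracMeasure μ C := by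
    intro C hC
    rw [measure_eq_tsum_fiber (measurable_digit 0) hμ.fracMeasure_digit_zero_notMem
      ((measurable_digit 0 hs).inter (measurable_ArtinPsi hC)), ← ENNReal.tsum_mul_right]
    refine tsum_congr fun a => ?_
    split_ifs with has
    · rw [← hμ.fracMeasure_ArtinPsi_fiber a.2 hC]
      congr 1
      ext x
      simp only [Set.mem_inter_iff, Set.mem_preimage, Set.mem_ofPred_eq]
      exact ⟨fun h => ⟨h.1.2, h.2⟩, fun h => ⟨⟨h.2 ▸ has, h.1⟩, h.2⟩⟩
    · rw [zero_mul]
      convert measure_empty (μ := fracMeasure μ)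
      refine Set.eq_empty_of_forall_notMem fun x hx => has ?_
      exact hx.2 ▸ hx.1.1
  have h1 := key Set.univ MeasurableSet.univ
  rw [hμ.fracMeasure_univ, mul_one, Set.preimage_univ, Set.inter_univ] at h1
  rw [key B hB, h1]

lemma fracMeasure_digit_range (hμ : IsNormalizedHaar μ) (n : ℕ) {s : ℕ → Set (Khat k)}
    (hs : ∀ i, MeasurableSet (s i)) :
    fracMeasure μ {x | ∀ i < n, digit i x ∈ s i} =
      ∏ i ∈ Finset.range n, fracMeasure μ (digit 0 ⁻¹' s i) := by
  induction n generalizing s with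
  | zero => simpa using hμ.fracMeasure_univ
  | succ n ih =>
    have hm : MeasurableSet {x | ∀ i < n, digit i x ∈ s (i + 1)} := by
      simp only [Set.ofPred_forall]
      exact MeasurableSet.iInter fun i => MeasurableSet.iInter fun _ =>
        measurable_digit i (hs (i + 1))
    rw [Finset.prod_range_succ', ← ih fun i => hs (i + 1), mul_comm,
      ← hμ.fracMeasure_digit_zero_inter (hs 0) hm]
    congr 1
    ext x
    simp only [Set.mem_ofPred_eq, Set.mem_inter_iff, Set.mem_preimage, Nat.forall_lt_succ_left]
    rfl

/-- Under the normalized Haar measure on `X⁻¹O`, the digits are independent with law `ν`. -/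
lemma fracMeasure_digit (hμ : IsNormalizedHaar μ) (S : Finset ℕ) (c : ℕ → Khat k) :
    fracMeasure μ {x | ∀ i ∈ S, digit i x = c i} = ∏ i ∈ S, nuE k (c i) := by
  obtain ⟨n, hn⟩ := S.exists_nat_subset_range
  have h := hμ.fracMeasure_digit_range n (s := fun i => if i ∈ S then {c i} else Set.univ)
    fun i => by split_ifs <;> measurability
  have hset : {x : Khat k | ∀ i ∈ S, digit i x = c i} =
      {x | ∀ i < n, digit i x ∈ if i ∈ S then {c i} else Set.univ} := by
    ext x
    refine ⟨fun hx i _ => ?_, fun hx i hi => ?_⟩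
    · split_ifs with hi
      · exact hx i hi
      · trivial
    · simpa [hi] using hx i (Finset.mem_range.1 (hn hi))
  rw [hset, h, ← Finset.prod_subset hn fun i _ hi => ?_]
  · refine Finset.prod_congr rfl fun i hi => ?_
    rw [if_pos hi, hμ.fracMeasure_digit_zero]
  · rw [if_neg hi, Set.preimage_univ, hμ.fracMeasure_univ]

end IsNormalizedHaar

/-- The first marginal of `m̂`, as a measure on `J`. -/
def leftMeasure (μ : Measure (Khat k)) : Measure (Khat k) :=
  (μ.restrict (Jset k)).withDensity fun x =>
    Fintype.card k * ENNReal.ofReal ((absInf x ^ 2)⁻¹)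

lemma measurable_leftDensity : Measurable fun x : Khat k =>
    (Fintype.card k : ℝ≥0∞) * ENNReal.ofReal ((absInf x ^ 2)⁻¹) :=
  ((measurable_absInf.pow_const 2).inv.ennreal_ofReal).const_mul _

lemma measurableSet_Jset : MeasurableSet (Jset k) := by
  rw [Jset_eq]
  exact (measurableSet_fracIdeal 0).compl

lemma absInf_eq_of_intPart_eq {x a : Khat k} (ha : a ∈ AmK k) (h : intPart x = a) :
    absInf x = absInf a := by
  refine absInf_eq_of_sub_lt (lt_trans ?_ (one_lt_absInf (mem_AmK_iff.1 ha).2))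
  exact mem_fracIdeal_one_iff_absInf_lt.1 ((intPart_eq_iff (intPart_eq_self ha)).1 h)

lemma absInf_sub_of_mem {x y : Khat k} (hx : x ∈ Jset k) (hy : y ∈ XinvO k) :
    absInf (y - x) = absInf x := by
  rw [Jset_eq] at hx
  rw [XinvO_eq] at hy
  rw [absInf_sub_comm]
  refine absInf_eq_of_sub_lt ?_
  rw [sub_sub_cancel_left, absInf_neg]
  exact (mem_fracIdeal_one_iff_absInf_lt.1 hy).trans (one_lt_absInf hx)

namespace IsNormalizedHaar

variable {μ : Measure (Khat k)}

lemma leftMeasure_fiber (hμ : IsNormalizedHaar μ) {a : Khat k} (ha : a ∈ AmK k)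
    {E : Set (Khat k)} (hE : MeasurableSet E) :
    leftMeasure μ (E ∩ {x | intPart x = a}) =
      nuE k a * fracMeasure μ ((fun x => a + x) ⁻¹' E) := by
  have hm : MeasurableSet (E ∩ {x | intPart x = a}) :=
    hE.inter (measurable_intPart (measurableSet_singleton a))
  have hsub : E ∩ {x | intPart x = a} ⊆ Jset k := fun x hx => by
    rw [Jset_eq, Set.mem_ofPred_eq, mem_fracIdeal_iff_absInf_le, neg_zero, zpow_zero, not_le,
      absInf_eq_of_intPart_eq ha hx.2]
    exact one_lt_absInf (mem_AmK_iff.1 ha).2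
  rw [leftMeasure, withDensity_apply _ hm, setLIntegral_congr_fun
    (g := fun _ => Fintype.card k * nuE k a) hm fun x hx => ?_, setLIntegral_const,
    Measure.restrict_eq_self μ hsub, ← hμ.measure_preimage_add a hm,
    fracMeasure_apply μ (measurable_add_left a hE), mul_right_comm, mul_comm]
  · congr 3
    ext x
    simp [intPart_eq_iff (intPart_eq_self ha)]
  · simp only [absInf_eq_of_intPart_eq ha hx.2, nuE_of_mem ha]

lemma map_neg_inv_leftMeasure (hμ : IsNormalizedHaar μ) :
    (leftMeasure μ).map (fun x => -x⁻¹) = fracMeasure μ := by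
  have hφ : Measurable fun x : Khat k => -x⁻¹ :=
    isometry_neg.continuous.measurable.comp measurable_inv_Khat
  have hε : absInf (-1 : Khat k) = 1 := by rw [absInf_neg, absInf_one]
  ext B hB
  have h0 : leftMeasure μ {x | intPart x ∉ AmK k} = 0 := by
    refine withDensity_absolutelyContinuous _ _ ?_
    rw [Measure.restrict_apply (t := {x | intPart x ∉ AmK k})
      (measurable_intPart (countable_AmK k).measurableSet.compl)]
    convert measure_empty (μ := μ)
    refine Set.eq_empty_of_forall_notMem fun x hx => hx.1 (intPart_mem_AmK ?_)
    have := hx.2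
    rwa [Jset_eq] at this
  rw [Measure.map_apply hφ hB, measure_eq_tsum_fiber measurable_intPart h0 (hφ hB),
    measure_eq_tsum_fiber (measurable_intPart.comp (measurable_div (-1) hε))
      (hμ.fracMeasure_intPart_div_notMem hε) hB]
  refine tsum_congr fun a => ?_
  rw [hμ.leftMeasure_fiber a.2 (hφ hB)]
  refine Eq.trans ?_ (hμ.fracMeasure_fiber hε a.2 hB).symm
  simp only [Set.preimage, neg_div, one_div, Set.mem_ofPred_eq]

lemma leftMeasure_digit (hμ : IsNormalizedHaar μ) (S : Finset ℕ) (c : ℕ → Khat k) :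
    leftMeasure μ {x | ∀ i ∈ S, digit i (-x⁻¹) = c i} = ∏ i ∈ S, nuE k (c i) := by
  have hφ : Measurable fun x : Khat k => -x⁻¹ :=
    isometry_neg.continuous.measurable.comp measurable_inv_Khat
  have hm : MeasurableSet {x | ∀ i ∈ S, digit i x = c i} := by
    simp only [Set.ofPred_forall]
    exact MeasurableSet.iInter fun i => MeasurableSet.iInter fun _ =>
      measurable_digit i (measurableSet_singleton (c i))
  rw [← hμ.fracMeasure_digit, ← hμ.map_neg_inv_leftMeasure, Measure.map_apply hφ hm]
  rfl

lemma measure_Kset (hμ : IsNormalizedHaar μ) : μ (Kset k) = 0 := by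
  have : NullSingletonClass μ := ⟨fun {x} => hμ.measure_singleton x⟩
  exact (countable_Kset k).measure_zero μ

lemma OmegaSet_ae_eq (hμ : IsNormalizedHaar μ) :
    OmegaSet k =ᵐ[μ.prod μ] Jset k ×ˢ XinvO k := by
  have := hμ.sigmaFinite
  have hK : cK k =ᵐ[μ] Set.univ := by
    refine ae_eq_univ.2 ?_
    rw [cK, compl_compl, hμ.measure_Kset]
  refine Measure.set_prod_ae_eq ?_ ?_
  · simpa using (ae_eq_refl (Jset k)).inter hK
  · simpa using (ae_eq_refl (XinvO k)).inter hK

lemma mhat_eq_prod (hμ : IsNormalizedHaar μ) :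
    mhat k μ = (leftMeasure μ).prod (fracMeasure μ) := by
  have := hμ.sigmaFinite
  have hJ := measurableSet_Jset (k := k)
  have hV : MeasurableSet (XinvO k) := XinvO_eq (k := k) ▸ measurableSet_fracIdeal 1
  have hfrac : fracMeasure μ = (μ.restrict (XinvO k)).withDensity fun _ => Fintype.card k := by
    rw [withDensity_const, fracMeasure, XinvO_eq]
  rw [hfrac, leftMeasure, prod_withDensity measurable_leftDensity measurable_const,
    Measure.prod_restrict, mhat, Measure.restrict_congr_set
      (withDensity_absolutelyContinuous _ _ |>.ae_le hμ.OmegaSet_ae_eq),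
    restrict_withDensity (hJ.prod hV)]
  refine withDensity_congr_ae ((ae_restrict_iff' (hJ.prod hV)).2 (ae_of_all _ fun p hp => ?_))
  rw [dens, absInf_sub_of_mem hp.1 hp.2, ENNReal.ofReal_mul (by positivity),
    ENNReal.ofReal_pow (by positivity), ENNReal.ofReal_natCast]
  ring

end IsNormalizedHaar

lemma measurable_ThetaRaw : Measurable (ThetaRaw (k := k)) := by
  refine measurable_pi_iff.2 fun n => ?_
  simp only [ThetaRaw]
  split_ifs
  · exact (measurable_digit _).comp measurable_snd
  · exact (measurable_digit _).comp
      (isometry_neg.continuous.measurable.comp (measurable_inv_Khat.comp measurable_fst))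

end Auxiliary

/-- The pushforward of `m̂` under the coding map `Θ'` is the Bernoulli
product measure `ν^⊗ℤ`, where `ν(a) = |a|⁻² = q^(-2 deg a)` on `A∖k`: the measures of all
cylinder sets are the corresponding products. -/
theorem statement_10 (k : Type*) [Field k] [Fintype k] (μ : MeasureTheory.Measure (Khat k))
    (hinv : ∀ x : Khat k, MeasureTheory.Measure.map (fun y => x + y) μ = μ)
    (hO : μ (Oball k) = 1) :
    ∀ (S : Finset ℤ) (c : ℤ → Khat k),
      MeasureTheory.Measure.map (ThetaRaw (k := k)) (mhat k μ)
          {x : ℤ → Khat k | ∀ i ∈ S, x i = c i}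
        = ∏ i ∈ S, nuE k (c i) := by
  have hμ : IsNormalizedHaar μ := ⟨hinv, hO⟩
  have := hμ.sigmaFinite
  have : IsFiniteMeasure (fracMeasure μ) := ⟨by rw [hμ.fracMeasure_univ]; exact ENNReal.one_lt_top⟩
  have : SFinite (leftMeasure μ) := by unfold leftMeasure; infer_instance
  intro S c
  have hm : MeasurableSet {x : ℤ → Khat k | ∀ i ∈ S, x i = c i} := by
    simp only [Set.ofPred_forall]
    exact MeasurableSet.iInter fun i => MeasurableSet.iInter fun _ =>
      (measurable_pi_apply i : Measurable fun x : ℤ → Khat k => x i)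
        (measurableSet_singleton (c i))
  have hpre : ThetaRaw ⁻¹' {x : ℤ → Khat k | ∀ i ∈ S, x i = c i} =
      {x | ∀ j ∈ (S.filter fun i => ¬1 ≤ i).image fun i => (-i).toNat,
        digit j (-x⁻¹) = c (-j)} ×ˢ
      {y | ∀ j ∈ (S.filter fun i => 1 ≤ i).image fun i => (i - 1).toNat,
        digit j y = c (j + 1)} := by
    ext p
    simp only [Set.mem_preimage, Set.mem_ofPred_eq, Set.mem_prod, Finset.forall_mem_image,
      Finset.mem_filter, and_imp]
    refine ⟨fun h => ⟨fun i hi h1 => ?_, fun i hi h1 => ?_⟩, fun h i hi => ?_⟩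
    · have hi' := h i hi
      rw [ThetaRaw, if_neg h1] at hi'
      rw [hi']
      congr 1
      omega
    · have hi' := h i hi
      rw [ThetaRaw, if_pos h1] at hi'
      rw [hi']
      congr 1
      omega
    · rw [ThetaRaw]
      split_ifs with h1
      · rw [h.2 hi h1]
        congr 1
        omega
      · rw [h.1 hi h1]
        congr 1
        omega
  rw [Measure.map_apply measurable_ThetaRaw hm, hμ.mhat_eq_prod, hpre, Measure.prod_prod,
    hμ.leftMeasure_digit _ fun j => c (-j), hμ.fracMeasure_digit _ fun j => c (j + 1), mul_comm,
    Finset.prod_image, Finset.prod_image, ← Finset.prod_filter_mul_prod_filter_not S (1 ≤ ·)]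
  · congr 1
    · refine Finset.prod_congr rfl fun i hi => ?_
      have := (Finset.mem_filter.1 hi).2
      congr 2
      omega
    · refine Finset.prod_congr rfl fun i hi => ?_
      have := (Finset.mem_filter.1 hi).2
      congr 2
      omega
  · intro i hi j hj h
    simp only [Finset.coe_filter, Set.mem_ofPred_eq] at hi hj
    simp only at h
    omega
  · intro i hi j hj h
    simp only [Finset.coe_filter, Set.mem_ofPred_eq] at hi hj
    simp only at h
    omega

end ArtinCoding
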